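/- Let A = ℚ[x₁, …, x₆] be the polynomial ring in six variables over ℚ and let I = (x₁x₂ − x₄², x₂x₃ − x₅², x₄x₆, x₅x₆). Then for every natural number i, the Ext group Ext^i_A(A/I, A) is nonzero if and only if i ∈ {3, 4}. Equivalently, the deficiency modules K^j(A/I), whose underlying modules are Ext^{6−j}_A(A/I, A), are nonzero exactly for j ∈ {2, 3}. -/

import Mathlib

open MvPolynomial CategoryTheory

section Bridge

variable {R : Type} [CommRing R]

theorem CategoryTheory.ProjectiveResolution.nontrivial_ext_succ_iff {X Y : ModuleCat.{0} R}
    (P : ProjectiveResolution X) (n : ℕ) :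
    Nontrivial (((Ext R (ModuleCat.{0} R) (n + 1)).obj (Opposite.op X)).obj Y) ↔
      Nontrivial (Abelian.Ext X Y (n + 1)) := by
  rw [← not_iff_not, not_nontrivial_iff_subsingleton, not_nontrivial_iff_subsingleton,
    ← ModuleCat.isZero_iff_subsingleton, (P.isoExt (R := R) (n + 1) Y).isZero_iff,
    ← HomologicalComplex.exactAt_iff_isZero_homology,
    HomologicalComplex.exactAt_iff' _ n (n + 1) (n + 2) (by simp) (by simp),
    ShortComplex.moduleCat_exact_iff]
  refine ⟨fun h => ⟨fun a b => ?_⟩, fun h (f : P.complex.X (n + 1) ⟶ Y) hf => ?_⟩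
  · suffices ∀ c : Abelian.Ext X Y (n + 1), c = 0 by rw [this a, this b]
    intro c
    obtain ⟨f, hf, rfl⟩ := P.extMk_surjective c (n + 2) rfl
    rw [P.extMk_eq_zero_iff f (n + 2) rfl hf n rfl]
    exact h f hf
  · exact (P.extMk_eq_zero_iff f (n + 2) rfl hf n rfl).1 (Subsingleton.elim _ _)

theorem CategoryTheory.ProjectiveResolution.subsingleton_ext_zero {X Y : ModuleCat.{0} R}
    (P : ProjectiveResolution X) (h : Subsingleton (Abelian.Ext X Y 0)) :
    Subsingleton (((Ext R (ModuleCat.{0} R) 0).obj (Opposite.op X)).obj Y) := by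
  rw [← ModuleCat.isZero_iff_subsingleton, (P.isoExt (R := R) 0 Y).isZero_iff,
    ← HomologicalComplex.exactAt_iff_isZero_homology,
    HomologicalComplex.exactAt_iff' _ 0 0 1 (by simp) (by simp),
    ShortComplex.moduleCat_exact_iff]
  intro (f : P.complex.X 0 ⟶ Y) hf
  refine ⟨0, ?_⟩
  suffices f = 0 from (map_zero _).trans this.symm
  have hfd : P.complex.d 1 0 ≫ f = 0 := hf
  have hdesc : P.π.f 0 ≫ P.exact₀.gIsCokernel.desc (Limits.CokernelCofork.ofπ f hfd) = f :=
    P.exact₀.gIsCokernel.fac (Limits.CokernelCofork.ofπ f hfd) Limits.WalkingParallelPair.one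
  have hXY : Subsingleton (X ⟶ Y) := Abelian.Ext.homEquiv₀.symm.subsingleton
  have hzero : P.exact₀.gIsCokernel.desc (Limits.CokernelCofork.ofπ f hfd) = 0 :=
    hXY.elim _ _
  rw [← hdesc, hzero]
  exact Limits.comp_zero

end Bridge

section LongExactSequence

open Abelian

variable {R : Type} [CommRing R] {S : ShortComplex (ModuleCat.{0} R)} {Y : ModuleCat.{0} R}

theorem subsingleton_ext_middle (hS : S.ShortExact) {n : ℕ}
    (h₁ : Subsingleton (Abelian.Ext S.X₁ Y n))
    (h₃ : Subsingleton (Abelian.Ext S.X₃ Y n)) : Subsingleton (Abelian.Ext S.X₂ Y n) := by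
  refine subsingleton_of_forall_eq 0 fun x => ?_
  obtain ⟨y, rfl⟩ := Ext.contravariant_sequence_exact₂ hS Y x (Subsingleton.elim _ _)
  rw [Subsingleton.elim y 0, Ext.comp_zero]

theorem nontrivial_ext_middle_of_right (hS : S.ShortExact) {n : ℕ}
    (h₁ : Subsingleton (Abelian.Ext S.X₁ Y n))
    (h₃ : Nontrivial (Abelian.Ext S.X₃ Y (n + 1))) :
    Nontrivial (Abelian.Ext S.X₂ Y (n + 1)) := by
  obtain ⟨x, hx⟩ := exists_ne (0 : Abelian.Ext S.X₃ Y (n + 1))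
  refine nontrivial_of_ne ((Ext.mk₀ S.g).comp x (zero_add _)) 0 fun h => hx ?_
  obtain ⟨y, rfl⟩ := Ext.contravariant_sequence_exact₃ hS Y x h (add_comm 1 n)
  rw [Subsingleton.elim y 0, Ext.comp_zero]

theorem nontrivial_ext_middle_of_left (hS : S.ShortExact) {n : ℕ}
    (h₁ : Nontrivial (Abelian.Ext S.X₁ Y n))
    (h₃ : Subsingleton (Abelian.Ext S.X₃ Y (n + 1))) :
    Nontrivial (Abelian.Ext S.X₂ Y n) := by
  obtain ⟨x, hx⟩ := exists_ne (0 : Abelian.Ext S.X₁ Y n)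
  obtain ⟨y, rfl⟩ := Ext.contravariant_sequence_exact₁ hS Y x (add_comm 1 n)
    (Subsingleton.elim _ _)
  refine nontrivial_of_ne y 0 fun h => hx ?_
  rw [h, Ext.comp_zero]

end LongExactSequence

section ColonSequence

variable {R : Type} [CommRing R]

/-- The class of ideals `J` such that `Ext^i(R/J, R)` is `R/J` for `i = n` and zero otherwise. -/
structure IsExtConcentrated (J : Ideal R) (n : ℕ) : Prop where
  subsingleton : ∀ i ≠ n,
    Subsingleton (Abelian.Ext (ModuleCat.of R (R ⧸ J)) (ModuleCat.of R R) i)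
  equiv : Nonempty (Abelian.Ext (ModuleCat.of R (R ⧸ J)) (ModuleCat.of R R) n ≃ₗ[R] R ⧸ J)

/-- The short exact sequence `0 → R/(J : r) → R/J → R/(J + (r)) → 0`. -/
theorem exists_colon_shortExact {C J K : Ideal R} {r : R} (hC : ∀ x, x ∈ C ↔ r * x ∈ J)
    (hK : K = J ⊔ Ideal.span {r}) :
    ∃ (f : (R ⧸ C) →ₗ[R] R ⧸ J) (g : (R ⧸ J) →ₗ[R] R ⧸ K) (w : g ∘ₗ f = 0),
      (∀ x, f (Submodule.Quotient.mk x) = Submodule.Quotient.mk (r * x)) ∧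
      (ShortComplex.moduleCatMk f g w).ShortExact := by
  have hCJ : C ≤ Submodule.comap (LinearMap.mulLeft R r) J := fun x hx => (hC x).1 hx
  have hJK : J ≤ K := hK ▸ le_sup_left
  have hrK : r ∈ K := hK ▸ (le_sup_right : _ ≤ J ⊔ _) (Ideal.mem_span_singleton_self r)
  have w : Submodule.factor hJK ∘ₗ Submodule.mapQ C J (LinearMap.mulLeft R r) hCJ = 0 := by
    refine LinearMap.ext fun x => ?_
    obtain ⟨x, rfl⟩ := Submodule.Quotient.mk_surjective _ x
    exact (Submodule.Quotient.mk_eq_zero _).2 (K.mul_mem_right x hrK)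
  refine ⟨_, _, w, fun x => rfl, ?_⟩
  have hf : Function.Injective (Submodule.mapQ C J (LinearMap.mulLeft R r) hCJ) := by
    rw [← LinearMap.ker_eq_bot, LinearMap.ker_eq_bot']
    intro x hx
    obtain ⟨x, rfl⟩ := Submodule.Quotient.mk_surjective _ x
    exact (Submodule.Quotient.mk_eq_zero _).2
      ((hC x).2 ((Submodule.Quotient.mk_eq_zero _).1 hx))
  have hg : Function.Surjective (Submodule.factor hJK) := Submodule.factor_surjective hJK
  refine { exact := ?_, mono_f := (ModuleCat.mono_iff_injective _).2 hf
           epi_g := (ModuleCat.epi_iff_surjective _).2 hg }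
  rw [ShortComplex.moduleCat_exact_iff]
  intro (x : R ⧸ J) (hx : Submodule.factor hJK x = 0)
  obtain ⟨x, rfl⟩ := Submodule.Quotient.mk_surjective _ x
  have hx : x ∈ K := (Submodule.Quotient.mk_eq_zero _).1 hx
  rw [hK, Submodule.mem_sup] at hx
  obtain ⟨y, hy, z, hz, rfl⟩ := hx
  obtain ⟨c, rfl⟩ := Ideal.mem_span_singleton'.1 hz
  refine ⟨(Submodule.Quotient.mk c : R ⧸ C), ?_⟩
  refine (Submodule.Quotient.eq J).2 ?_
  change r * c - (y + c * r) ∈ J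
  rw [show r * c - (y + c * r) = -y by ring]
  exact neg_mem hy

theorem isExtConcentrated_bot : IsExtConcentrated (⊥ : Ideal R) 0 := by
  have e : (R ⧸ (⊥ : Ideal R)) ≃ₗ[R] R := Submodule.quotEquivOfEqBot _ rfl
  have : Module.Projective R (R ⧸ (⊥ : Ideal R)) := Module.Projective.of_equiv e.symm
  have : Projective (ModuleCat.of R (R ⧸ (⊥ : Ideal R))) := inferInstance
  refine ⟨fun i hi => ?_, ⟨?_⟩⟩
  · obtain ⟨i, rfl⟩ := Nat.exists_eq_succ_of_ne_zero hi
    exact subsingleton_of_forall_eq 0 fun x => Abelian.Ext.eq_zero_of_projective x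
  · exact Abelian.Ext.linearEquiv₀ (R := R) ≪≫ₗ ModuleCat.homLinearEquiv (S := R) ≪≫ₗ
      LinearEquiv.congrLeft R R e ≪≫ₗ LinearMap.ringLmapEquivSelf R R R ≪≫ₗ e.symm

theorem IsExtConcentrated.nontrivial {J : Ideal R} {n : ℕ} (h : IsExtConcentrated J n)
    (hJ : J ≠ ⊤) :
    Nontrivial (Abelian.Ext (ModuleCat.of R (R ⧸ J)) (ModuleCat.of R R) n) := by
  have : Nontrivial (R ⧸ J) := Ideal.Quotient.nontrivial_iff.2 hJ
  exact h.equiv.some.toEquiv.nontrivial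

theorem IsExtConcentrated.sup_span_singleton {J : Ideal R} {n : ℕ} (h : IsExtConcentrated J n)
    {r : R} (hr : ∀ x, r * x ∈ J → x ∈ J) :
    IsExtConcentrated (J ⊔ Ideal.span {r}) (n + 1) := by
  obtain ⟨f, g, w, hf, hS⟩ := exists_colon_shortExact (C := J) (K := J ⊔ Ideal.span {r})
    (fun x => ⟨fun hx => J.mul_mem_left r hx, hr x⟩) rfl
  obtain ⟨e⟩ := h.equiv
  have hfx (x : R ⧸ J) : f x = r • x := by
    obtain ⟨x, rfl⟩ := Submodule.Quotient.mk_surjective _ x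
    exact hf x
  have hfr : ModuleCat.ofHom f = r • 𝟙 (ModuleCat.of R (R ⧸ J)) :=
    ModuleCat.hom_ext (LinearMap.ext hfx)
  have hmul (i : ℕ) (x : Abelian.Ext (ModuleCat.of R (R ⧸ J)) (ModuleCat.of R R) i) :
      (Abelian.Ext.mk₀ (ModuleCat.ofHom f)).comp x (zero_add i) = r • x := by
    rw [hfr, Abelian.Ext.mk₀_smul, Abelian.Ext.smul_comp, Abelian.Ext.mk₀_id_comp]
  have hinj (x : R ⧸ J) (hx : r • x = 0) : x = 0 := by
    obtain ⟨x, rfl⟩ := Submodule.Quotient.mk_surjective _ x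
    exact (Submodule.Quotient.mk_eq_zero _).2 (hr x ((Submodule.Quotient.mk_eq_zero _).1 hx))
  have hinjE (i : ℕ) (x : Abelian.Ext (ModuleCat.of R (R ⧸ J)) (ModuleCat.of R R) i)
      (hx : r • x = 0) : x = 0 := by
    by_cases hi : i = n
    · subst hi
      exact e.injective (by rw [map_zero, hinj (e x) (by rw [← map_smul, hx, map_zero])])
    · have := h.subsingleton i hi
      exact Subsingleton.elim _ _
  have hgzero (i : ℕ)
      (x : Abelian.Ext (ModuleCat.of R (R ⧸ J ⊔ Ideal.span {r})) (ModuleCat.of R R) i) :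
      (Abelian.Ext.mk₀ (ModuleCat.ofHom g)).comp x (zero_add i) = 0 := by
    apply hinjE
    rw [← hmul]
    have := (ShortComplex.moduleCatMk f g w).zero
    change ModuleCat.ofHom f ≫ ModuleCat.ofHom g = 0 at this
    rw [Abelian.Ext.mk₀_comp_mk₀_assoc, this, Abelian.Ext.mk₀_zero, Abelian.Ext.zero_comp]
  refine ⟨fun i hi => subsingleton_of_forall_eq 0 fun x => ?_, ⟨?_⟩⟩
  · rcases i with _ | i
    · have := hS.epi_g
      exact Abelian.Ext.precomp_mk₀_injective_of_epi _ (ShortComplex.moduleCatMk f g w).g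
        ((hgzero 0 x).trans (map_zero _).symm)
    · obtain ⟨y, rfl⟩ :=
        Abelian.Ext.contravariant_sequence_exact₃ hS _ x (hgzero _ x) (add_comm 1 i)
      have := h.subsingleton i (by lia)
      obtain rfl : y = 0 := this.elim _ _
      exact Abelian.Ext.comp_zero ..
  · let δ : Abelian.Ext (ModuleCat.of R (R ⧸ J)) (ModuleCat.of R R) n →ₗ[R]
        Abelian.Ext (ModuleCat.of R (R ⧸ J ⊔ Ideal.span {r})) (ModuleCat.of R R) (n + 1) :=
      hS.extClass.precompOfLinear R (ModuleCat.of R R) (add_comm 1 n)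
    have hδ : Function.Surjective δ := fun x =>
      Abelian.Ext.contravariant_sequence_exact₃ hS _ x (hgzero _ x) (add_comm 1 n)
    let π : Abelian.Ext (ModuleCat.of R (R ⧸ J)) (ModuleCat.of R R) n →ₗ[R]
        R ⧸ J ⊔ Ideal.span {r} := g ∘ₗ e.toLinearMap
    have hg : Function.Surjective g := (ModuleCat.epi_iff_surjective _).1 hS.epi_g
    have hπ : Function.Surjective π := hg.comp e.surjective
    have hker : LinearMap.ker δ = LinearMap.ker π := by
      ext x
      rw [LinearMap.mem_ker, LinearMap.mem_ker]
      constructor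
      · intro hx
        obtain ⟨y, rfl⟩ := Abelian.Ext.contravariant_sequence_exact₁ hS _ x (add_comm 1 n) hx
        have hy : e ((Abelian.Ext.mk₀ (ModuleCat.ofHom f)).comp y (zero_add n)) = f (e y) :=
          (congrArg e (hmul n y)).trans ((map_smul e r _).trans (hfx _).symm)
        exact (congrArg g hy).trans (LinearMap.congr_fun w _)
      · intro hx
        obtain ⟨y, hy⟩ : ∃ y, f y = e x :=
          (ShortComplex.moduleCat_exact_iff _).1 hS.exact (e x) hx
        have hxy : x = r • e.symm y := e.injective <| by
          rw [map_smul, e.apply_symm_apply, ← hy]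
          exact hfx y
        rw [hxy, ← hmul]
        exact hS.extClass_comp_assoc _ (h := add_comm 1 n)
    exact (δ.quotKerEquivOfSurjective hδ).symm ≪≫ₗ Submodule.quotEquivOfEq _ _ hker ≪≫ₗ
      π.quotKerEquivOfSurjective hπ

end ColonSequence

section ToricFaceRing

local notation "A" => MvPolynomial (Fin 6) ℚ

/-- The substitution setting the variables in `s` to zero. -/
noncomputable def killVars (s : Finset (Fin 6)) : A →ₐ[ℚ] A :=
  aeval fun i => if i ∈ s then 0 else X i

theorem killVars_X (s : Finset (Fin 6)) (i : Fin 6) :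
    killVars s (X i) = if i ∈ s then 0 else X i :=
  aeval_X _ i

theorem killVars_sub_mem (s : Finset (Fin 6)) {J : Ideal A} (hs : ∀ i ∈ s, X i ∈ J) (p : A) :
    p - killVars s p ∈ J := by
  rw [← Ideal.Quotient.eq_zero_iff_mem, map_sub, sub_eq_zero]
  suffices (Ideal.Quotient.mkₐ ℚ J) = (Ideal.Quotient.mkₐ ℚ J).comp (killVars s) from
    AlgHom.congr_fun this p
  ext i
  by_cases hi : i ∈ s
  · simpa [killVars_X, hi] using Ideal.Quotient.eq_zero_iff_mem.2 (hs i hi)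
  · simp [killVars_X, hi]

theorem mem_of_killVars_mem {s : Finset (Fin 6)} {J : Ideal A} (hs : ∀ i ∈ s, X i ∈ J) {p : A}
    (hp : killVars s p ∈ J) : p ∈ J := by
  simpa using add_mem (killVars_sub_mem s hs p) hp

theorem mem_span_image_X_iff (s : Finset (Fin 6)) (p : A) :
    p ∈ Ideal.span (X '' (s : Set (Fin 6))) ↔ killVars s p = 0 := by
  have hs : ∀ i ∈ s, (X i : A) ∈ Ideal.span (X '' (s : Set (Fin 6))) := fun i hi =>
    Ideal.subset_span (Set.mem_image_of_mem _ hi)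
  refine ⟨fun h => ?_, fun h => mem_of_killVars_mem hs (h ▸ zero_mem _)⟩
  have : Ideal.span (X '' (s : Set (Fin 6))) ≤ RingHom.ker (killVars s) := by
    rw [Ideal.span_le]
    rintro _ ⟨i, hi, rfl⟩
    have hi : i ∈ s := hi
    simp [RingHom.mem_ker, killVars_X, hi]
  exact this h

/-- A polynomial nonzero modulo the variables in `s` is regular modulo those variables. -/
theorem mem_span_image_X_of_mul_mem {s : Finset (Fin 6)} {r : A} (hr : killVars s r ≠ 0) (p : A)
    (hp : r * p ∈ Ideal.span (X '' (s : Set (Fin 6)))) :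
    p ∈ Ideal.span (X '' (s : Set (Fin 6))) := by
  rw [mem_span_image_X_iff] at hp ⊢
  rw [map_mul] at hp
  exact (mul_eq_zero.1 hp).resolve_left hr

theorem isExtConcentrated_span_image_X (s : Finset (Fin 6)) :
    IsExtConcentrated (Ideal.span (X '' (s : Set (Fin 6))) : Ideal A) s.card := by
  induction s using Finset.induction_on with
  | empty => simpa using isExtConcentrated_bot (R := A)
  | insert i s hi ih =>
    have h := ih.sup_span_singleton (r := X i)
      (mem_span_image_X_of_mul_mem (by simp [killVars_X, hi]))
    rwa [← Ideal.span_union, Set.union_singleton, ← Set.image_insert_eq, ← Finset.coe_insert,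
      ← Finset.card_insert_of_notMem hi] at h

theorem prime_quadric : Prime (X 0 * X 1 - X 3 ^ 2 : A) := by
  have h := irreducible_mul_X_add (n := Fin 6) (R := ℚ) (X 1) (-X 3 ^ 2) 0 (X_ne_zero _)
    (by simp) (fun h => by
      rw [vars_neg] at h
      simpa using vars_pow _ _ h) (by
      rw [(X_prime (R := ℚ) (i := (1 : Fin 6))).irreducible.isRelPrime_iff_not_dvd]
      rintro ⟨q, hq⟩
      simpa using congrArg (eval ![0, 0, 0, 1, 0, 0]) hq)
  convert h.prime using 1
  ring

theorem isExtConcentrated_link :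
    IsExtConcentrated
      (Ideal.span {(X 5 : A), X 0 * X 1 - X 3 ^ 2, X 1 * X 2 - X 4 ^ 2}) 3 := by
  have h₁ := isExtConcentrated_span_image_X {5}
  have h₂ := h₁.sup_span_singleton (r := X 0 * X 1 - X 3 ^ 2)
    (mem_span_image_X_of_mul_mem (by
      simpa [killVars_X] using prime_quadric.ne_zero))
  have h₃ := h₂.sup_span_singleton (r := X 1 * X 2 - X 4 ^ 2) fun x hx => by
    rw [← Ideal.span_union] at hx ⊢
    simp only [Finset.coe_singleton, Set.image_singleton, Set.singleton_union,
      Ideal.mem_span_pair] at hx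
    obtain ⟨u, v, h⟩ := hx
    have h' := congrArg (killVars {5}) h
    simp [killVars_X] at h'
    have hdvd : (X 0 * X 1 - X 3 ^ 2 : A) ∣ killVars {5} x := by
      refine (prime_quadric.dvd_or_dvd ⟨_, h'.symm.trans (mul_comm _ _)⟩).resolve_left ?_
      rintro ⟨q, hq⟩
      simpa using congrArg (eval ![0, 1, 1, 0, 0, 0]) hq
    refine mem_of_killVars_mem (s := {5}) ?_ ?_
    · simpa using Ideal.subset_span (by simp)
    · exact Ideal.mem_of_dvd _ hdvd (Ideal.subset_span (by simp))
  rw [← Ideal.span_union, ← Ideal.span_union] at h₃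
  simpa [Set.insert_union, Set.insert_comm, Set.pair_comm] using h₃

/-- The colon ideal `(I : x₆)` of the toric face ring ideal `I`. -/
noncomputable def colonIdeal : Ideal A := Ideal.span {X 3, X 4, X 0 * X 1, X 1 * X 2}

theorem mem_span_quadruple {R : Type} [CommRing R] {a b c d x : R} :
    x ∈ Ideal.span {a, b, c, d} ↔ ∃ s t u v, s * a + t * b + u * c + v * d = x := by
  simp only [Ideal.mem_span_insert, Ideal.mem_span_singleton']
  constructor
  · rintro ⟨s, _, ⟨t, _, ⟨u, _, ⟨v, rfl⟩, rfl⟩, rfl⟩, rfl⟩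
    exact ⟨s, t, u, v, by ring⟩
  · rintro ⟨s, t, u, v, rfl⟩
    exact ⟨s, _, ⟨t, _, ⟨u, _, ⟨v, rfl⟩, rfl⟩, rfl⟩, by ring⟩

theorem mem_colonIdeal_iff (x : A) :
    x ∈ colonIdeal ↔ X 5 * x ∈ Ideal.span
      {(X 0 * X 1 - X 3 ^ 2 : A), X 1 * X 2 - X 4 ^ 2, X 3 * X 5, X 4 * X 5} := by
  rw [colonIdeal]
  constructor
  · rw [mem_span_quadruple]
    rintro ⟨s, t, u, v, rfl⟩
    rw [mem_span_quadruple]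
    exact ⟨u * X 5, v * X 5, s + u * X 3, t + v * X 4, by ring⟩
  · intro hx
    obtain ⟨s, t, u, v, h⟩ := mem_span_quadruple.1 hx
    refine mem_of_killVars_mem (s := {3, 4}) ?_ ?_
    · simp only [Finset.mem_insert, Finset.mem_singleton, forall_eq_or_imp, forall_eq]
      exact ⟨Ideal.subset_span (by simp), Ideal.subset_span (by simp)⟩
    have h₁ := congrArg (killVars {3, 4}) h
    simp [killVars_X] at h₁
    have h₂ := congrArg (killVars {5}) h₁
    simp [killVars_X] at h₂
    have h5 (p : A) : (X 5 : A) ∣ p - killVars {5} p := by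
      rw [← Ideal.mem_span_singleton]
      exact killVars_sub_mem {5} (by simp) p
    obtain ⟨s', hs'⟩ := h5 (killVars {3, 4} s)
    obtain ⟨t', ht'⟩ := h5 (killVars {3, 4} t)
    refine mem_span_quadruple.2 ⟨0, 0, s', t',
      mul_left_cancel₀ (X_ne_zero (R := ℚ) (5 : Fin 6)) ?_⟩
    linear_combination h₁ - h₂ - X 0 * X 1 * hs' - X 1 * X 2 * ht'

theorem mul_mem_colonIdeal_iff (x : A) :
    x ∈ Ideal.span (X '' ((({0, 2, 3, 4} : Finset (Fin 6)) : Set (Fin 6)))) ↔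
      X 1 * x ∈ colonIdeal := by
  have hC : (X '' ((({0, 2, 3, 4} : Finset (Fin 6)) : Set (Fin 6))) : Set A) =
      {X 0, X 2, X 3, X 4} := by simp [Set.image_insert_eq]
  rw [hC, colonIdeal]
  constructor
  · rw [mem_span_quadruple, mem_span_quadruple]
    rintro ⟨s, t, u, v, rfl⟩
    exact ⟨u * X 1, v * X 1, s, t, by ring⟩
  · intro hx
    obtain ⟨s, t, u, v, h⟩ := mem_span_quadruple.1 hx
    refine mem_of_killVars_mem (s := {3, 4}) ?_ ?_
    · simp only [Finset.mem_insert, Finset.mem_singleton, forall_eq_or_imp, forall_eq]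
      exact ⟨Ideal.subset_span (by simp), Ideal.subset_span (by simp)⟩
    have h₁ := congrArg (killVars {3, 4}) h
    simp [killVars_X] at h₁
    refine mem_span_quadruple.2 ⟨killVars {3, 4} u, killVars {3, 4} v, 0, 0,
      mul_left_cancel₀ (X_ne_zero (R := ℚ) (1 : Fin 6)) ?_⟩
    linear_combination h₁

theorem span_image_X_ne_top (s : Finset (Fin 6)) :
    (Ideal.span (X '' (s : Set (Fin 6))) : Ideal A) ≠ ⊤ := by
  rw [Ne, Ideal.eq_top_iff_one, mem_span_image_X_iff, map_one]
  exact one_ne_zero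

theorem nontrivial_ext_colonIdeal_iff (i : ℕ) :
    Nontrivial (Abelian.Ext (ModuleCat.of A (A ⧸ colonIdeal)) (ModuleCat.of A A) i) ↔
      i = 3 ∨ i = 4 := by
  obtain ⟨f, g, w, -, hS⟩ := exists_colon_shortExact mul_mem_colonIdeal_iff
    (K := Ideal.span (X '' ((({1, 3, 4} : Finset (Fin 6)) : Set (Fin 6))))) (by
      refine le_antisymm ?_ (sup_le ?_ ?_)
      · rw [colonIdeal, ← Ideal.span_union]
        refine Ideal.span_mono ?_
        simp [Set.image_insert_eq, Set.insert_subset_iff]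
      · rw [colonIdeal, Ideal.span_le]
        simp only [Set.insert_subset_iff, Set.singleton_subset_iff, SetLike.mem_coe]
        simp only [mem_span_image_X_iff]
        simp [killVars_X]
      · rw [Ideal.span_singleton_le_iff_mem, mem_span_image_X_iff]
        simp [killVars_X])
  have h₁ := isExtConcentrated_span_image_X {0, 2, 3, 4}
  have h₃ := isExtConcentrated_span_image_X {1, 3, 4}
  rw [show ({0, 2, 3, 4} : Finset (Fin 6)).card = 4 from rfl] at h₁
  rw [show ({1, 3, 4} : Finset (Fin 6)).card = 3 from rfl] at h₃
  constructor
  · contrapose!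
    intro hi
    exact subsingleton_ext_middle hS (h₁.subsingleton i hi.2) (h₃.subsingleton i hi.1)
  · rintro (rfl | rfl)
    · exact nontrivial_ext_middle_of_right hS (h₁.subsingleton 2 (by lia))
        (h₃.nontrivial (span_image_X_ne_top _))
    · exact nontrivial_ext_middle_of_left hS (h₁.nontrivial (span_image_X_ne_top _))
        (h₃.subsingleton 5 (by lia))

end ToricFaceRing

/-- Let `A = ℚ[x₁, …, x₆]` (with `xᵢ = X (i-1)`) and
`I = (x₁x₂ − x₄², x₂x₃ − x₅², x₄x₆, x₅x₆)`. Then `Ext^i_A(A/I, A) ≠ 0` if and only if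
`i ∈ {3, 4}`; equivalently, the deficiency modules `K^j(A/I) = Ext^{6-j}_A(A/I, A(-6))`
are nonzero exactly for `j ∈ {2, 3}`. -/
theorem ext_nonzero_iff_toric_face_ring_example (i : ℕ) :
    Nontrivial
      (((Ext (MvPolynomial (Fin 6) ℚ) (ModuleCat (MvPolynomial (Fin 6) ℚ)) i).obj
          (Opposite.op (ModuleCat.of (MvPolynomial (Fin 6) ℚ)
            (MvPolynomial (Fin 6) ℚ ⧸ Ideal.span
              {(X 0 * X 1 - X 3 ^ 2 : MvPolynomial (Fin 6) ℚ),
                X 1 * X 2 - X 4 ^ 2, X 3 * X 5, X 4 * X 5})))).obj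
        (ModuleCat.of (MvPolynomial (Fin 6) ℚ) (MvPolynomial (Fin 6) ℚ))) ↔
      i = 3 ∨ i = 4 := by
  obtain ⟨f, g, w, -, hS⟩ := exists_colon_shortExact mem_colonIdeal_iff
    (K := Ideal.span {X 5, X 0 * X 1 - X 3 ^ 2, X 1 * X 2 - X 4 ^ 2}) (by
      refine le_antisymm ?_ (sup_le ?_ ?_)
      · rw [← Ideal.span_union]
        refine Ideal.span_mono ?_
        simp [Set.insert_subset_iff]
      · rw [Ideal.span_le]
        have h5 : (X 5 : MvPolynomial (Fin 6) ℚ) ∈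
          Ideal.span {X 5, X 0 * X 1 - X 3 ^ 2, X 1 * X 2 - X 4 ^ 2} :=
            Ideal.subset_span (by simp)
        simp only [Set.insert_subset_iff, Set.singleton_subset_iff]
        exact ⟨Ideal.subset_span (by simp), Ideal.subset_span (by simp),
          Ideal.mul_mem_left _ _ h5, Ideal.mul_mem_left _ _ h5⟩
      · exact Ideal.span_mono (by simp))
  have h₃ := isExtConcentrated_link
  have key (i : ℕ) : Nontrivial (Abelian.Ext
      (ModuleCat.of (MvPolynomial (Fin 6) ℚ) (MvPolynomial (Fin 6) ℚ ⧸ Ideal.span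
        {(X 0 * X 1 - X 3 ^ 2 : MvPolynomial (Fin 6) ℚ), X 1 * X 2 - X 4 ^ 2, X 3 * X 5,
          X 4 * X 5}))
      (ModuleCat.of (MvPolynomial (Fin 6) ℚ) (MvPolynomial (Fin 6) ℚ)) i) ↔ i = 3 ∨ i = 4 := by
    constructor
    · contrapose!
      intro hi
      refine subsingleton_ext_middle hS ?_ (h₃.subsingleton i hi.1)
      rw [← not_nontrivial_iff_subsingleton]
      exact fun h => (nontrivial_ext_colonIdeal_iff i).not.2 (by tauto) h
    · intro hi
      exact nontrivial_ext_middle_of_left hS ((nontrivial_ext_colonIdeal_iff i).2 hi)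
        (h₃.subsingleton _ (by lia))
  let P := ProjectiveResolution.of
    (ModuleCat.of (MvPolynomial (Fin 6) ℚ) (MvPolynomial (Fin 6) ℚ ⧸ Ideal.span
      {(X 0 * X 1 - X 3 ^ 2 : MvPolynomial (Fin 6) ℚ), X 1 * X 2 - X 4 ^ 2, X 3 * X 5,
        X 4 * X 5}))
  rcases i with _ | i
  · have h₀ := (key 0).not.2 (by lia)
    rw [not_nontrivial_iff_subsingleton] at h₀
    have h := P.subsingleton_ext_zero h₀
    rw [← not_nontrivial_iff_subsingleton] at h
    exact iff_of_false h (by lia)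
  · rw [P.nontrivial_ext_succ_iff, key]
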